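/- Let Q ∈ ℝ^{a×a} be positive semidefinite, R ∈ ℝ^{b×b} positive semidefinite, F ∈ ℝ^{a×b}, G ∈ ℝ^{a×p}, and let c : ℝ^p → ℝ be any function. Then the function f₁ : ℝ^{b×p} × ℝ → ℝ given by f₁(Φ_u, γ) = sup over {w ∈ ℝ^p : ‖w‖₂ ≤ 1} of (wᵀ((FΦ_u + G)ᵀQ(FΦ_u + G) + Φ_uᵀRΦ_u)w − c(w)) − γ is convex (jointly in the matrix Φ_u and the scalar γ). -/

import Mathlib

open Matrix

/-- The Euclidean (ℓ₂) norm of a vector in `ℝ^n`. -/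
noncomputable def norm2 {n : ℕ} (v : Fin n → ℝ) : ℝ := Real.sqrt (∑ i, v i ^ 2)

theorem Matrix.PosSemidef.convexOn_dotProduct_mulVec {n : Type*} [Fintype n]
    {Q : Matrix n n ℝ} (hQ : Q.PosSemidef) :
    ConvexOn ℝ Set.univ (fun v : n → ℝ => v ⬝ᵥ Q *ᵥ v) := by
  refine ⟨convex_univ, fun x _ y _ s t hs ht hst => ?_⟩
  have h : 0 ≤ (x - y) ⬝ᵥ Q *ᵥ (x - y) := by
    simpa using hQ.dotProduct_mulVec_nonneg (x - y)
  obtain rfl : t = 1 - s := by linarith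
  simp only [mulVec_sub, mulVec_add, mulVec_smul, dotProduct_sub, sub_dotProduct,
    dotProduct_add, add_dotProduct, dotProduct_smul, smul_dotProduct, smul_eq_mul] at h ⊢
  nlinarith [mul_nonneg (mul_nonneg hs ht) h]

theorem dotProduct_transpose_mul_mul_mulVec {m n : Type*} [Fintype m] [Fintype n]
    (A : Matrix m n ℝ) (Q : Matrix m m ℝ) (w : n → ℝ) :
    w ⬝ᵥ (Aᵀ * Q * A) *ᵥ w = (A *ᵥ w) ⬝ᵥ Q *ᵥ (A *ᵥ w) := by
  rw [← mulVec_mulVec, ← mulVec_mulVec, dotProduct_mulVec, vecMul_transpose]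

theorem bddAbove_range_dotProduct_mulVec {p : ℕ} (M : Matrix (Fin p) (Fin p) ℝ) :
    BddAbove (Set.range fun w : {w : Fin p → ℝ // norm2 w ≤ 1} => w.1 ⬝ᵥ M *ᵥ w.1) := by
  have hc : Continuous fun w : Fin p → ℝ => w ⬝ᵥ M *ᵥ w := by fun_prop
  refine ((isCompact_Icc (a := (-1 : Fin p → ℝ)) (b := 1)).bddAbove_image
    hc.continuousOn).mono ?_
  rintro _ ⟨⟨w, hw⟩, rfl⟩
  have habs (i : Fin p) : |w i| ≤ 1 := by
    refine le_trans ?_ hw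
    rw [norm2, ← Real.sqrt_sq_eq_abs]
    exact Real.sqrt_le_sqrt
      (Finset.single_le_sum (fun j _ => sq_nonneg (w j)) (Finset.mem_univ i))
  exact ⟨w, ⟨fun i => (abs_le.1 (habs i)).1, fun i => (abs_le.1 (habs i)).2⟩, rfl⟩

/-- A pointwise supremum of nonnegative convex functions, each family bounded above, stays convex
after subtracting an arbitrary offset: the offset alone decides whether the suprema are finite. -/
theorem convexOn_iSup_sub {E ι : Type*} [AddCommGroup E] [Module ℝ E] [Nonempty ι]
    {s : Set E} (hs : Convex ℝ s) {q : E → ι → ℝ} (c : ι → ℝ)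
    (hq : ∀ i, ConvexOn ℝ s fun z => q z i) (h0 : ∀ z i, 0 ≤ q z i)
    (hb : ∀ z, BddAbove (Set.range (q z))) :
    ConvexOn ℝ s fun z => ⨆ i, (q z i - c i) := by
  by_cases hc : BddAbove (Set.range fun i => -c i)
  · have hbdd (z : E) : BddAbove (Set.range fun i => q z i - c i) := by
      obtain ⟨B, hB⟩ := hb z
      obtain ⟨C, hC⟩ := hc
      refine ⟨B + C, ?_⟩
      rintro _ ⟨i, rfl⟩
      have h1 : q z i ≤ B := hB ⟨i, rfl⟩
      have h2 : -c i ≤ C := hC ⟨i, rfl⟩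
      show q z i - c i ≤ B + C
      linarith
    refine ⟨hs, fun x hx y hy a b ha hb' hab => ciSup_le fun i => ?_⟩
    have h := (hq i).2 hx hy ha hb' hab
    have h1 := mul_le_mul_of_nonneg_left (le_ciSup (hbdd x) i) ha
    have h2 := mul_le_mul_of_nonneg_left (le_ciSup (hbdd y) i) hb'
    have h3 : c i = a * c i + b * c i := by rw [← add_mul, hab, one_mul]
    simp only [smul_eq_mul] at h h1 h2 ⊢
    linarith
  · have hzero (z : E) : ⨆ i, (q z i - c i) = 0 := by
      refine Real.iSup_of_not_bddAbove fun ⟨B, hB⟩ => hc ⟨B, ?_⟩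
      rintro _ ⟨i, rfl⟩
      have h1 : q z i - c i ≤ B := hB ⟨i, rfl⟩
      have h2 := h0 z i
      show -c i ≤ B
      linarith
    simpa only [hzero] using convexOn_const (0 : ℝ) hs

theorem regret_constraint_function_convex {a b p : ℕ}
    {Q : Matrix (Fin a) (Fin a) ℝ} {R : Matrix (Fin b) (Fin b) ℝ}
    (hQ : Q.PosSemidef) (hR : R.PosSemidef)
    (F : Matrix (Fin a) (Fin b) ℝ) (G : Matrix (Fin a) (Fin p) ℝ)
    (c : (Fin p → ℝ) → ℝ) :
    ConvexOn ℝ Set.univ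
      (fun z : Matrix (Fin b) (Fin p) ℝ × ℝ =>
        (⨆ w : {w : Fin p → ℝ // norm2 w ≤ 1},
          ((w : Fin p → ℝ) ⬝ᵥ
              ((F * z.1 + G)ᵀ * Q * (F * z.1 + G) + z.1ᵀ * R * z.1).mulVec w -
            c w)) - z.2) := by
  have : Nonempty {w : Fin p → ℝ // norm2 w ≤ 1} := ⟨⟨0, by simp [norm2]⟩⟩
  have hsup := convexOn_iSup_sub (E := Matrix (Fin b) (Fin p) ℝ × ℝ) convex_univ
    (q := fun z (w : {w : Fin p → ℝ // norm2 w ≤ 1}) =>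
      w.1 ⬝ᵥ ((F * z.1 + G)ᵀ * Q * (F * z.1 + G) + z.1ᵀ * R * z.1) *ᵥ w.1)
    (fun w => c w.1) (fun w => ?_) (fun z w => ?_)
    fun z => bddAbove_range_dotProduct_mulVec _
  · exact hsup.sub ((LinearMap.snd ℝ (Matrix (Fin b) (Fin p) ℝ) ℝ).concaveOn convex_univ)
  · simp only [add_mulVec, dotProduct_add, dotProduct_transpose_mul_mul_mulVec]
    refine ConvexOn.add ⟨convex_univ, fun x _ y _ s t hs ht hst => ?_⟩
      ⟨convex_univ, fun x _ y _ s t hs ht hst => ?_⟩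
    · have h := hQ.convexOn_dotProduct_mulVec.2 (Set.mem_univ ((F * x.1) *ᵥ w.1 + G *ᵥ w.1))
        (Set.mem_univ ((F * y.1) *ᵥ w.1 + G *ᵥ w.1)) hs ht hst
      have hG : G *ᵥ w.1 = s • G *ᵥ w.1 + t • G *ᵥ w.1 := by rw [← add_smul, hst, one_smul]
      have hv : (F * (s • x + t • y).1) *ᵥ w.1 + G *ᵥ w.1 =
          s • ((F * x.1) *ᵥ w.1 + G *ᵥ w.1) + t • ((F * y.1) *ᵥ w.1 + G *ᵥ w.1) := by
        conv_lhs => rw [hG]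
        simp only [Prod.fst_add, Prod.smul_fst, Matrix.mul_add, Matrix.mul_smul, add_mulVec,
          smul_mulVec, smul_add]
        abel
      rw [← hv] at h
      exact h
    · simpa only [Prod.fst_add, Prod.smul_fst, add_mulVec, smul_mulVec] using
        hR.convexOn_dotProduct_mulVec.2 (Set.mem_univ (x.1 *ᵥ w.1)) (Set.mem_univ (y.1 *ᵥ w.1))
          hs ht hst
  · rw [add_mulVec, dotProduct_add, dotProduct_transpose_mul_mul_mulVec,
      dotProduct_transpose_mul_mul_mulVec]
    exact add_nonneg (by simpa using hQ.dotProduct_mulVec_nonneg ((F * z.1 + G) *ᵥ w.1))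
      (by simpa using hR.dotProduct_mulVec_nonneg (z.1 *ᵥ w.1))
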